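/- For all n ≥ 0 and k ≥ 1, the total number of corners of type B summed over all set partitions of [n+1] with exactly k blocks equals (n/2)·S(n+1,k) − (1/4)·S(n+2,k) − (n/2)·S(n,k) + (5/4)·S(n+1,k) + (1/4)·S(n,k−2) (an identity in ℚ). -/

import Mathlib

/-- Number of corners of type B of a bargraph with column heights `L`
(with `L[m] := 0`): indices `i` (0-based, `i ≤ m-1`) with `L[i] > L[i+1]`. -/
def cornerB (L : List ℕ) : ℕ :=
  ((Finset.range L.length).filter (fun i => L.getD (i + 1) 0 < L.getD i 0)).card

/-- `w` is the canonical word of a set partition: a word over positive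
integers with `w 0 = 1` and `w (i+1) ≤ 1 + max(w 0, …, w i)`. -/
def IsCanonicalWord (w : List ℕ) : Prop :=
  (∀ x ∈ w, 0 < x) ∧ (w ≠ [] → w.getD 0 0 = 1) ∧
  ∀ i, i + 1 < w.length → w.getD (i + 1) 0 ≤ 1 + (w.take (i + 1)).foldr max 0

/-- Stirling number of the second kind: the number of set partitions of an
`n`-element set into `k` nonempty blocks. -/
noncomputable def stirling (n k : ℕ) : ℕ :=
  Nat.card {p : Finpartition (Finset.univ : Finset (Fin n)) // p.parts.card = k}

lemma M_append (w : List ℕ) (x : ℕ) :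
    (w ++ [x]).foldr max 0 = max (w.foldr max 0) x := by
  induction w with
  | nil => simp
  | cons a w ih => simp only [List.cons_append, List.foldr_cons, ih, max_assoc]

lemma le_M (w : List ℕ) : ∀ x ∈ w, x ≤ w.foldr max 0 := by
  induction w with
  | nil => simp
  | cons a w ih =>
    intro x hx
    rcases List.mem_cons.1 hx with rfl | h
    · simp
    · simp [ih x h]

lemma getD_app_lt (w : List ℕ) (x i : ℕ) (h : i < w.length) :
    (w ++ [x]).getD i 0 = w.getD i 0 := by
  simp [List.getD, List.getElem?_append_left h]

lemma getD_app_eq (w : List ℕ) (x : ℕ) :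
    (w ++ [x]).getD w.length 0 = x := by
  simp [List.getD]

lemma canon_append (w : List ℕ) (x : ℕ) :
    IsCanonicalWord (w ++ [x]) ↔
      IsCanonicalWord w ∧ 0 < x ∧ x ≤ 1 + w.foldr max 0 := by
  rcases Nat.eq_zero_or_pos w.length with h0 | h0
  · have : w = [] := List.length_eq_zero_iff.1 h0
    subst this
    simp [IsCanonicalWord]
    omega
  · have hne : w ≠ [] := List.length_pos_iff.1 h0
    constructor
    · rintro ⟨h1, h2, h3⟩
      refine ⟨⟨fun y hy => h1 y (by simp [hy]), fun _ => ?_, fun i hi => ?_⟩, h1 x (by simp), ?_⟩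
      · rw [← getD_app_lt w x 0 h0]; exact h2 (by simp)
      · have := h3 i (by simp; omega)
        rwa [getD_app_lt w x _ hi, List.take_append_of_le_length (by omega)] at this
      · have := h3 (w.length - 1) (by simp; omega)
        rw [show w.length - 1 + 1 = w.length by omega, getD_app_eq] at this
        simpa using this
    · rintro ⟨⟨h1, h2, h3⟩, hx, hxM⟩
      refine ⟨?_, fun _ => ?_, fun i hi => ?_⟩
      · intro y hy
        rcases List.mem_append.1 hy with h | h
        · exact h1 y h
        · simp at h; omega
      · rw [getD_app_lt w x 0 h0]; exact h2 hne
      · simp at hi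
        rcases Nat.lt_or_ge (i+1) w.length with h | h
        · rw [getD_app_lt w x _ h, List.take_append_of_le_length (by omega)]
          exact h3 i h
        · have : i + 1 = w.length := by omega
          rw [this, getD_app_eq]
          simpa using hxM

lemma canon_nil : IsCanonicalWord [] := by simp [IsCanonicalWord]

lemma mem_canon (w : List ℕ) (hw : IsCanonicalWord w) (x : ℕ) :
    x ∈ w ↔ 0 < x ∧ x ≤ w.foldr max 0 := by
  induction w using List.reverseRecOn with
  | nil => simp; omega
  | append_singleton w y ih =>
    rw [canon_append] at hw
    rw [M_append, List.mem_append, ih hw.1, List.mem_singleton]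
    omega

lemma exists_getD (w : List ℕ) (x : ℕ) (h : x ∈ w) : ∃ i < w.length, w.getD i 0 = x := by
  obtain ⟨i, hi, rfl⟩ := List.getElem_of_mem h
  exact ⟨i, hi, by simp [hi]⟩

lemma getD_mem' (w : List ℕ) (i : ℕ) (h : i < w.length) : w.getD i 0 ∈ w := by
  simp [h]

lemma exists_word {β : Type*} (f : ℕ → β) (n : ℕ) : ∃ w, IsCanonicalWord w ∧ w.length = n ∧
    ∀ i < n, ∀ j < n, (w.getD i 0 = w.getD j 0 ↔ f i = f j) := by
  induction n with
  | zero => exact ⟨[], canon_nil, rfl, by simp⟩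
  | succ n ih =>
    obtain ⟨w, hw, hl, h⟩ := ih
    have key : ∃ x, 0 < x ∧ x ≤ 1 + w.foldr max 0 ∧ ∀ i < n, (w.getD i 0 = x ↔ f i = f n) := by
      by_cases hex : ∃ i < n, f i = f n
      · obtain ⟨i, hi, hfi⟩ := hex
        have hm := (mem_canon w hw _).1 (getD_mem' w i (by omega))
        exact ⟨w.getD i 0, hm.1, by omega, fun j hj => by rw [h j hj i hi, hfi]⟩
      · push Not at hex
        refine ⟨1 + w.foldr max 0, by omega, le_rfl, fun i hi => ?_⟩
        have hm := (mem_canon w hw _).1 (getD_mem' w i (by omega))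
        have := hex i hi
        constructor
        · intro h; omega
        · intro h; exact absurd h this
    obtain ⟨x, hx, hxM, hxe⟩ := key
    refine ⟨w ++ [x], (canon_append w x).2 ⟨hw, hx, hxM⟩, by simp [hl], ?_⟩
    have e1 : ∀ i < n, (w ++ [x]).getD i 0 = w.getD i 0 := fun i hi =>
      getD_app_lt w x i (by omega)
    have e2 : (w ++ [x]).getD n 0 = x := by rw [← hl]; exact getD_app_eq w x
    intro i hi j hj
    rcases Nat.lt_succ_iff_lt_or_eq.1 hi with hi | rfl <;>
    rcases Nat.lt_succ_iff_lt_or_eq.1 hj with hj | rfl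
    · rw [e1 i hi, e1 j hj]; exact h i hi j hj
    · rw [e1 i hi, e2]; exact hxe i hi
    · rw [e1 j hj, e2, eq_comm, hxe j hj, eq_comm]
    · simp

lemma unique_word (w : List ℕ) : ∀ v : List ℕ, IsCanonicalWord w → IsCanonicalWord v →
    w.length = v.length →
    (∀ i < w.length, ∀ j < w.length, (w.getD i 0 = w.getD j 0 ↔ v.getD i 0 = v.getD j 0)) →
    w = v := by
  induction w using List.reverseRecOn with
  | nil => intro v _ _ h _; exact (List.length_eq_zero_iff.1 h.symm).symm
  | append_singleton w x ih =>
    intro v hw hv hl h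
    induction v using List.reverseRecOn with
    | nil => simp at hl
    | append_singleton v y _ =>
      rw [canon_append] at hw hv
      simp only [List.length_append, List.length_singleton] at hl h
      have hl' : w.length = v.length := by omega
      have : w = v := by
        apply ih v hw.1 hv.1 hl'
        intro i hi j hj
        have := h i (by omega) j (by omega)
        rwa [getD_app_lt _ _ _ hi, getD_app_lt _ _ _ hj, getD_app_lt _ _ _ (by omega),
          getD_app_lt _ _ _ (by omega)] at this
      subst this
      have h' : ∀ i < w.length, (w.getD i 0 = x ↔ w.getD i 0 = y) := by
        intro i hi
        have := h i (by omega) w.length (by omega)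
        rwa [getD_app_lt _ _ _ hi, getD_app_lt _ _ _ hi, getD_app_eq, getD_app_eq] at this
      have hxy : x = y := by
        by_cases hx : x ≤ w.foldr max 0
        · obtain ⟨i, hi, e⟩ := exists_getD w x ((mem_canon w hw.1 x).2 ⟨hw.2.1, hx⟩)
          rw [← e]; exact (h' i hi).1 e
        · by_cases hy : y ≤ w.foldr max 0
          · obtain ⟨i, hi, e⟩ := exists_getD w y ((mem_canon w hw.1 y).2 ⟨hv.2.1, hy⟩)
            rw [← e]; exact ((h' i hi).2 e).symm
          · omega
      rw [hxy]

def WW : ℕ → ℕ → Finset (List ℕ)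
  | 0, 0 => {[]}
  | 0, _ + 1 => ∅
  | _ + 1, 0 => ∅
  | n + 1, k + 1 => (WW n (k + 1) ×ˢ Finset.Icc 1 (k + 1)).image (fun p => p.1 ++ [p.2]) ∪
      (WW n k).image (fun w => w ++ [k + 1])

lemma mem_WW (n : ℕ) : ∀ k w, w ∈ WW n k ↔
    IsCanonicalWord w ∧ w.length = n ∧ w.foldr max 0 = k := by
  induction n with
  | zero =>
    intro k w
    rcases k with _ | k
    · simp only [WW, Finset.mem_singleton]
      constructor
      · rintro rfl; exact ⟨canon_nil, rfl, rfl⟩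
      · rintro ⟨_, h, _⟩; exact List.length_eq_zero_iff.1 h
    · simp only [WW, Finset.notMem_empty, false_iff]
      rintro ⟨_, h, h2⟩
      rw [List.length_eq_zero_iff.1 h] at h2
      simp at h2
  | succ n ih =>
    intro k w
    induction w using List.reverseRecOn with
    | nil => rcases k with _ | k <;> simp [WW]
    | append_singleton w x _ =>
      rw [canon_append, M_append]
      rcases k with _ | k
      · simp only [WW, Finset.notMem_empty, false_iff]
        omega
      · simp only [WW, Finset.mem_union, Finset.mem_image, Finset.mem_product, ih, Prod.exists,
          Finset.mem_Icc, List.append_singleton_inj, List.length_append, List.length_singleton]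
        constructor
        · rintro (⟨u, y, ⟨⟨hu, hl, hM⟩, hy⟩, rfl, rfl⟩ | ⟨u, ⟨hu, hl, hM⟩, rfl, rfl⟩)
          · refine ⟨⟨hu, ?_, ?_⟩, ?_, ?_⟩ <;> omega
          · refine ⟨⟨hu, ?_, ?_⟩, ?_, ?_⟩ <;> omega
        · rintro ⟨⟨hu, h1, h2⟩, hl, hM⟩
          by_cases hx : w.foldr max 0 = k + 1
          · exact Or.inl ⟨w, x, ⟨⟨hu, by omega, hx⟩, by omega⟩, rfl, rfl⟩
          · exact Or.inr ⟨w, ⟨hu, by omega, by omega⟩, rfl, by omega⟩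

lemma sum_WW (n k : ℕ) (f : List ℕ → ℚ) :
    ∑ w ∈ WW (n + 1) (k + 1), f w =
      ∑ w ∈ WW n (k + 1), ∑ x ∈ Finset.Icc 1 (k + 1), f (w ++ [x]) +
      ∑ w ∈ WW n k, f (w ++ [k + 1]) := by
  rw [WW, Finset.sum_union, Finset.sum_image, Finset.sum_image, Finset.sum_product]
  · intro a _ b _ h
    simpa using h
  · rintro ⟨a, x⟩ _ ⟨b, y⟩ _ h
    simpa using h
  · rw [Finset.disjoint_left]
    intro w h1 h2
    simp only [Finset.mem_image, Finset.mem_product, Prod.exists, mem_WW] at h1 h2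
    obtain ⟨u, y, ⟨⟨_, _, hM⟩, hy⟩, rfl⟩ := h1
    obtain ⟨v, ⟨_, _, hM'⟩, e⟩ := h2
    rw [List.append_singleton_inj] at e
    rw [e.1] at hM'
    omega

lemma card_WW (n : ℕ) : ∀ k, (WW n k).card = Nat.stirlingSecond n k := by
  induction n with
  | zero => intro k; rcases k with _ | k <;> simp [WW]
  | succ n ih =>
    intro k
    rcases k with _ | k
    · simp [WW]
    · have := sum_WW n k (fun _ => 1)
      simp only [Finset.sum_const, ih, Nat.card_Icc, nsmul_eq_mul, mul_one] at this
      rw [Nat.stirlingSecond_succ_succ]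
      have h2 : (((WW (n+1) (k+1)).card : ℕ) : ℚ) =
        (((k + 1) * Nat.stirlingSecond n (k + 1) + Nat.stirlingSecond n k : ℕ) : ℚ) := by
        rw [this]; push_cast [Nat.add_sub_cancel]; ring
      exact_mod_cast h2

/-- last letter -/
def lastL (w : List ℕ) : ℕ := w.getD (w.length - 1) 0

lemma lastL_app (w : List ℕ) (x : ℕ) : lastL (w ++ [x]) = x := by
  simp [lastL]

lemma cornerB_app (w : List ℕ) (x : ℕ) (hx : 0 < x) (hw : w ≠ []) (hl : 0 < lastL w) :
    cornerB (w ++ [x]) = cornerB w + if x < lastL w then 1 else 0 := by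
  induction w using List.reverseRecOn with
  | nil => exact absurd rfl hw
  | append_singleton w y _ =>
    rw [lastL_app] at *
    have e0 : ∀ (u : List ℕ), u.getD u.length 0 = 0 := by intro u; simp
    simp only [cornerB, Finset.card_filter]
    rw [List.length_append, List.length_singleton, Finset.sum_range_succ]
    rw [List.length_append, List.length_singleton, Finset.sum_range_succ, Finset.sum_range_succ]
    have a1 : (w ++ [y] ++ [x]).getD (w.length + 1) 0 = x := by
      simpa using getD_app_eq (w ++ [y]) x
    have a2 : (w ++ [y] ++ [x]).getD (w.length + 1 + 1) 0 = 0 := by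
      simpa using e0 (w ++ [y] ++ [x])
    have a3 : (w ++ [y] ++ [x]).getD w.length 0 = y := by
      rw [getD_app_lt _ _ _ (by simp), getD_app_eq]
    have a4 : (w ++ [y]).getD (w.length + 1) 0 = 0 := by
      simpa using e0 (w ++ [y])
    have a5 : (w ++ [y]).getD w.length 0 = y := getD_app_eq w y
    rw [a1, a2, a3, a4, a5, if_pos hx, if_pos hl]
    have : ∀ i ∈ Finset.range w.length,
        (if (w ++ [y] ++ [x]).getD (i + 1) 0 < (w ++ [y] ++ [x]).getD i 0 then 1 else 0) =
        (if (w ++ [y]).getD (i + 1) 0 < (w ++ [y]).getD i 0 then 1 else 0) := by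
      intro i hi
      rw [Finset.mem_range] at hi
      rw [getD_app_lt (w ++ [y]) x (i+1) (by simp; omega),
        getD_app_lt (w ++ [y]) x i (by simp; omega)]
    rw [Finset.sum_congr rfl this]
    ring

lemma sum_last (n k : ℕ) : ∑ w ∈ WW (n + 1) (k + 1), (lastL w : ℚ) =
    ((k + 1 : ℚ) * (k + 2) / 2) * Nat.stirlingSecond n (k + 1) +
      (k + 1) * Nat.stirlingSecond n k := by
  have g : ∀ m : ℕ, ∑ x ∈ Finset.Icc 1 m, (x : ℚ) = m * (m + 1) / 2 := by
    intro m
    induction m with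
    | zero => simp
    | succ m ih => rw [Finset.sum_Icc_succ_top (by omega), ih]; push_cast; ring
  rw [sum_WW]
  simp only [lastL_app, g, Finset.sum_const, card_WW, nsmul_eq_mul]
  push_cast; ring

lemma sum_lt (m l : ℕ) (h1 : 1 ≤ l) (h2 : l ≤ m) :
    ∑ x ∈ Finset.Icc 1 m, (if x < l then (1 : ℚ) else 0) = l - 1 := by
  rw [← Finset.sum_filter, Finset.sum_const]
  have : (Finset.Icc 1 m).filter (fun x => x < l) = Finset.Icc 1 (l - 1) := by
    ext x; simp; omega
  rw [this]
  simp [Nat.cast_sub h1]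

lemma WW_facts {n k : ℕ} {w : List ℕ} (h : w ∈ WW (n + 1) k) :
    w ≠ [] ∧ 0 < lastL w ∧ lastL w ≤ k := by
  rw [mem_WW] at h
  obtain ⟨hc, hl, hM⟩ := h
  have := (mem_canon w hc _).1 (getD_mem' w (w.length - 1) (by omega))
  refine ⟨by rintro rfl; simp at hl, this.1, hM ▸ this.2⟩

lemma sum_corner (n k : ℕ) : ∑ w ∈ WW (n + 2) (k + 1), (cornerB w : ℚ) =
    (k + 1) * ∑ w ∈ WW (n + 1) (k + 1), (cornerB w : ℚ) + ∑ w ∈ WW (n + 1) k, (cornerB w : ℚ) +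
    ∑ w ∈ WW (n + 1) (k + 1), (lastL w : ℚ) - Nat.stirlingSecond (n + 1) (k + 1) := by
  rw [sum_WW]
  have e1 : ∀ w ∈ WW (n + 1) (k + 1), ∑ x ∈ Finset.Icc 1 (k + 1), (cornerB (w ++ [x]) : ℚ) =
      (k + 1) * (cornerB w : ℚ) + ((lastL w : ℚ) - 1) := by
    intro w hw
    obtain ⟨h1, h2, h3⟩ := WW_facts hw
    rw [← sum_lt (k + 1) (lastL w) h2 h3]
    have : ∀ x ∈ Finset.Icc 1 (k + 1), (cornerB (w ++ [x]) : ℚ) =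
        cornerB w + (if x < lastL w then (1 : ℚ) else 0) := by
      intro x hx
      rw [Finset.mem_Icc] at hx
      rw [cornerB_app w x (by omega) h1 h2]
      push_cast; rfl
    rw [Finset.sum_congr rfl this, Finset.sum_add_distrib]
    simp
  have e2 : ∀ w ∈ WW (n + 1) k, (cornerB (w ++ [k + 1]) : ℚ) = cornerB w := by
    intro w hw
    obtain ⟨h1, h2, h3⟩ := WW_facts hw
    rw [cornerB_app w _ (by omega) h1 h2, if_neg (by omega)]
    simp
  rw [Finset.sum_congr rfl e1, Finset.sum_congr rfl e2, Finset.sum_add_distrib,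
    Finset.sum_sub_distrib, ← Finset.mul_sum]
  simp only [Finset.sum_const, card_WW, nsmul_eq_mul]
  ring

def FF (n k : ℕ) : ℚ := ((n : ℚ) / 2) * Nat.stirlingSecond (n + 1) k
  - (1 / 4) * Nat.stirlingSecond (n + 2) k -
        ((n : ℚ) / 2) * Nat.stirlingSecond n k + (5 / 4) * Nat.stirlingSecond (n + 1) k +
        (if 2 ≤ k then (1 / 4) * (Nat.stirlingSecond n (k - 2) : ℚ) else 0)

lemma total (n : ℕ) : ∀ k, ∑ w ∈ WW (n + 1) (k + 1), (cornerB w : ℚ) = FF n (k + 1) := by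
  induction n with
  | zero =>
    intro k
    rcases k with _ | _ | k
    · rw [sum_WW]
      have h1 : cornerB [1] = 1 := by decide
      simp [WW, FF, h1, Nat.stirlingSecond]
      norm_num
    · simp [WW, FF, Nat.stirlingSecond]
    · simp [WW, FF, Nat.stirlingSecond]
  | succ n ih =>
    intro k
    rw [sum_corner, sum_last, ih]
    rcases k with _ | _ | _ | k
    · rcases n with _ | n
      · simp [WW, FF, Nat.stirlingSecond_succ_succ]; try norm_num
      · simp [WW, FF, Nat.stirlingSecond_succ_succ]
        try ring
    · rw [ih]
      rcases n with _ | n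
      · simp [FF, Nat.stirlingSecond_succ_succ]; norm_num
      · simp [FF, Nat.stirlingSecond_succ_succ]
        try ring
    · rw [ih]
      rcases n with _ | n
      · simp [FF, Nat.stirlingSecond_succ_succ]; try norm_num
      · simp [FF, Nat.stirlingSecond_succ_succ]
        try ring
    · rw [ih]
      simp [FF, Nat.stirlingSecond_succ_succ]
      ring

lemma card_image_congr' {α β γ : Type*} [Fintype α] [DecidableEq β] [DecidableEq γ]
    (f : α → β) (g : α → γ) (h : ∀ i j, f i = f j ↔ g i = g j) :
    (Finset.univ.image f).card = (Finset.univ.image g).card := by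
  have key : ∀ {δ : Type _} [DecidableEq δ] (f : α → δ),
      (Finset.univ.image f).card = Nat.card (Quotient (Setoid.ker f)) := by
    intro δ _ f
    rw [Nat.card_congr (Setoid.quotientKerEquivRange f), ← Set.ncard_coe_finset]
    simp [Set.ncard, Set.encard, Nat.card]
  have e : Setoid.ker f = Setoid.ker g := by
    ext i j; exact h i j
  have key2 : ∀ {δ : Type _} [DecidableEq δ] (f : α → δ),
      (Finset.univ.image f).card = Nat.card (Quotient (Setoid.ker f)) := by
    intro δ _ f
    rw [Nat.card_congr (Setoid.quotientKerEquivRange f), ← Set.ncard_coe_finset]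
    simp [Set.ncard, Set.encard, Nat.card]
  rw [key f, key2 g, e]

lemma parts_eq_image {n : ℕ} (p : Finpartition (Finset.univ : Finset (Fin n))) :
    p.parts = Finset.univ.image p.part := by
  ext t
  rw [Finset.mem_image]
  constructor
  · intro ht
    obtain ⟨a, ha⟩ := p.nonempty_of_mem_parts ht
    exact ⟨a, Finset.mem_univ _, p.part_eq_of_mem ht ha⟩
  · rintro ⟨a, _, rfl⟩
    exact p.part_mem.2 (Finset.mem_univ a)

lemma word_card {n : ℕ} (w : List ℕ) (hw : IsCanonicalWord w) (hl : w.length = n) :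
    (Finset.univ.image (fun i : Fin n => w.getD i 0)).card = w.foldr max 0 := by
  have : Finset.univ.image (fun i : Fin n => w.getD i 0) = Finset.Icc 1 (w.foldr max 0) := by
    ext x
    rw [Finset.mem_Icc, Finset.mem_image]
    constructor
    · rintro ⟨i, _, rfl⟩
      exact (mem_canon w hw _).1 (getD_mem' w i (by omega))
    · intro hx
      obtain ⟨i, hi, e⟩ := exists_getD w x ((mem_canon w hw x).2 hx)
      exact ⟨⟨i, by omega⟩, Finset.mem_univ _, e⟩
  rw [this]; simp

lemma word_of_partition {n : ℕ} (p : Finpartition (Finset.univ : Finset (Fin n))) :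
    ∃ w, IsCanonicalWord w ∧ w.length = n ∧
    ∀ i j : Fin n, (w.getD i 0 = w.getD j 0 ↔ p.part i = p.part j) := by
  obtain ⟨w, h1, h2, h3⟩ := exists_word (fun i => if h : i < n then p.part ⟨i, h⟩ else ∅) n
  refine ⟨w, h1, h2, fun i j => ?_⟩
  have := h3 i i.2 j j.2
  simpa using this

lemma stirling_eq (n k : ℕ) : stirling n k = Nat.stirlingSecond n k := by
  classical
  rw [← card_WW, stirling, ← Fintype.card_coe, ← Nat.card_eq_fintype_card]
  choose F hF1 hF2 hF3 using fun p : Finpartition (Finset.univ : Finset (Fin n)) =>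
    word_of_partition p
  have hcard : ∀ p, p.parts.card = (F p).foldr max 0 := by
    intro p
    rw [← word_card (F p) (hF1 p) (hF2 p), parts_eq_image]
    exact card_image_congr' _ _ (fun i j => (hF3 p i j).symm)
  refine Nat.card_congr (Equiv.ofBijective
    (fun p => ⟨F p.1, (mem_WW n k _).2 ⟨hF1 _, hF2 _, by rw [← hcard, p.2]⟩⟩) ⟨?_, ?_⟩)
  · rintro ⟨p, hp⟩ ⟨q, hq⟩ h
    have h : F p = F q := by simpa using h
    have hpq : p.part = q.part := by
      funext b
      ext a
      rw [p.mem_part_iff_part_eq_part (Finset.mem_univ _) (Finset.mem_univ _),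
        q.mem_part_iff_part_eq_part (Finset.mem_univ _) (Finset.mem_univ _), ← hF3, ← hF3, h]
    apply Subtype.ext
    apply Finpartition.ext
    rw [parts_eq_image p, parts_eq_image q, hpq]
  · rintro ⟨w, hw⟩
    obtain ⟨h1, h2, h3⟩ := (mem_WW n k _).1 hw
    let p := Finpartition.ofSetoid (Setoid.ker (fun i : Fin n => w.getD i 0))
    have hp : F p = w := by
      apply unique_word _ _ (hF1 p) h1 (by rw [hF2, h2])
      intro i hi j hj
      rw [hF2] at hi hj
      rw [hF3 p ⟨i, hi⟩ ⟨j, hj⟩,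
        ← p.mem_part_iff_part_eq_part (Finset.mem_univ _) (Finset.mem_univ _),
        Finpartition.mem_part_ofSetoid_iff_rel]
      exact eq_comm
    exact ⟨⟨p, by rw [hcard, hp, h3]⟩, Subtype.ext hp⟩

/-- The total number of corners of type B over all set partitions of `[n+1]` with exactly
`k` blocks equals `(n/2)S(n+1,k) − (1/4)S(n+2,k) − (n/2)S(n,k) + (5/4)S(n+1,k) + (1/4)S(n,k−2)`
(where `S(n, k-2) = 0` when `k < 2`). -/
theorem stmt15 (n k : ℕ) (hk : 1 ≤ k) :
    ((∑ᶠ w : {w : List ℕ //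
        IsCanonicalWord w ∧ w.length = n + 1 ∧ w.foldr max 0 = k}, cornerB w.1 : ℕ) : ℚ) =
      ((n : ℚ) / 2) * stirling (n + 1) k - (1 / 4) * stirling (n + 2) k -
        ((n : ℚ) / 2) * stirling n k + (5 / 4) * stirling (n + 1) k +
        (if 2 ≤ k then (1 / 4) * (stirling n (k - 2) : ℚ) else 0) := by
  have hs : (∑ᶠ w : {w : List ℕ //
        IsCanonicalWord w ∧ w.length = n + 1 ∧ w.foldr max 0 = k}, cornerB w.1) =
      ∑ w ∈ WW (n + 1) k, cornerB w := by
    rw [← finsum_mem_coe_finset, ← finsum_set_coe_eq_finsum_mem]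
    have : {w : List ℕ | IsCanonicalWord w ∧ w.length = n + 1 ∧ w.foldr max 0 = k} =
        (WW (n + 1) k : Set (List ℕ)) := by
      ext w; simp [mem_WW]
    rw [← this]
    rfl
  obtain ⟨k, rfl⟩ : ∃ j, k = j + 1 := ⟨k - 1, by omega⟩
  rw [hs]
  rw [Nat.cast_sum, total]
  simp only [stirling_eq, FF]
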